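/- arXiv:2105.13202 — 6 statements merged into one kernel-verified Lean document; each statement's English description precedes it below -/
import Mathlib

section
/- Let (f⁺, f⁻) be a Vickrey queue flow for an arc with transit time τ > 0 and capacity ν > 0. Then for every θ ≥ 0 one has F⁻(θ + τ + z(θ + τ)/ν) = F⁺(θ); that is, the flow volume that has entered the arc by time θ has completely left the arc exactly at the exit time T(θ) := θ + τ + z(θ + τ)/ν. -/
open MeasureTheory

/-- The cumulative function `F(θ) = ∫₀^θ f(ξ) dξ` of a rate function `f`. -/
noncomputable def cumul (f : ℝ → ℝ) (θ : ℝ) : ℝ := ∫ ξ in (0:ℝ)..θ, f ξ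

/-- A Vickrey queue flow for an arc with transit time `τ` and capacity `ν`: a pair
`(fi, fo)` of nonnegative, bounded, locally integrable inflow/outflow rates vanishing on
`(−∞, 0)`, whose queue size `z(θ) = F⁺(θ − τ) − F⁻(θ)` is nonnegative, and such that for
almost every `θ`: `fo θ = ν` if `z θ > 0`, and `fo θ = min (fi (θ − τ)) ν` if `z θ = 0`. -/
def IsVickreyFlow (τ ν : ℝ) (fi fo : ℝ → ℝ) : Prop :=
  (∀ θ, 0 ≤ fi θ) ∧ (∀ θ, 0 ≤ fo θ) ∧
  (∃ M : ℝ, ∀ θ, fi θ ≤ M ∧ fo θ ≤ M) ∧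
  LocallyIntegrable fi ∧ LocallyIntegrable fo ∧
  (∀ θ < (0:ℝ), fi θ = 0) ∧ (∀ θ < (0:ℝ), fo θ = 0) ∧
  (∀ θ : ℝ, 0 ≤ cumul fi (θ - τ) - cumul fo θ) ∧
  (∀ᵐ θ : ℝ ∂volume,
    (0 < cumul fi (θ - τ) - cumul fo θ → fo θ = ν) ∧
    (cumul fi (θ - τ) - cumul fo θ = 0 → fo θ = min (fi (θ - τ)) ν))

lemma intervalIntegrable_of_locallyIntegrable {f : ℝ → ℝ} (hf : LocallyIntegrable f) (a b : ℝ) :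
    IntervalIntegrable f volume a b :=
  (hf.integrableOn_isCompact isCompact_uIcc).intervalIntegrable

lemma cumul_sub_cumul {f : ℝ → ℝ} (hf : LocallyIntegrable f) (a b : ℝ) :
    cumul f b - cumul f a = ∫ ξ in a..b, f ξ :=
  intervalIntegral.integral_interval_sub_left (intervalIntegrable_of_locallyIntegrable hf _ _)
    (intervalIntegrable_of_locallyIntegrable hf _ _)

lemma cumul_mono {f : ℝ → ℝ} (hf : LocallyIntegrable f) (h0 : ∀ t, 0 ≤ f t) :
    Monotone (cumul f) := fun a b hab => by
  rw [← sub_nonneg, cumul_sub_cumul hf]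
  exact intervalIntegral.integral_nonneg hab fun t _ => h0 t

/-- The flow volume that has entered the arc by time `θ` has completely left the arc
exactly at the exit time `T(θ) = θ + τ + z(θ + τ)/ν`. -/
theorem outflow_at_exit_time_eq_inflow (τ ν : ℝ) (hτ : 0 < τ) (hν : 0 < ν)
    (fi fo : ℝ → ℝ) (hV : IsVickreyFlow τ ν fi fo) (θ : ℝ) (hθ : 0 ≤ θ) :
    cumul fo (θ + τ + (cumul fi θ - cumul fo (θ + τ)) / ν) = cumul fi θ := by
  obtain ⟨hi0, ho0, -, hi, ho, -, -, hz, hae⟩ := hV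
  have hza := hz (θ + τ)
  rw [add_sub_cancel_right] at hza
  set a := θ + τ with ha
  set b := a + (cumul fi θ - cumul fo a) / ν with hb
  have hab : a ≤ b := le_add_of_nonneg_right (div_nonneg hza hν.le)
  have hconst : ∫ _ in a..b, ν = cumul fi θ - cumul fo a := by
    rw [intervalIntegral.integral_const, smul_eq_mul, hb]
    field_simp
    ring
  have hsub := cumul_sub_cumul ho a b
  have hcap : ∀ᵐ t : ℝ, fo t ≤ ν := by
    filter_upwards [hae] with t ht
    rcases (hz t).lt_or_eq with h | h
    · exact (ht.1 h).le
    · exact (ht.2 h.symm).trans_le (min_le_right _ _)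
  have hle : ∫ t in a..b, fo t ≤ ∫ _ in a..b, ν :=
    intervalIntegral.integral_mono_ae hab (intervalIntegrable_of_locallyIntegrable ho _ _)
      intervalIntegrable_const hcap
  refine le_antisymm (by linarith) (not_lt.mp fun hlt => ?_)
  have heq : ∫ t in a..b, fo t = ∫ _ in a..b, ν := by
    refine intervalIntegral.integral_congr_ae ?_
    filter_upwards [hae] with t ht htab
    rw [Set.uIoc_of_le hab] at htab
    refine ht.1 ?_
    have h1 := cumul_mono ho ho0 htab.2
    have h2 : cumul fi θ ≤ cumul fi (t - τ) := cumul_mono hi hi0 (by linarith [htab.1])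
    linarith
  linarith
end

section
/- Let c > 0 and let a : ℕ → ℝ satisfy a(0) = c and a(t+1) = c + a(t) − ⌊a(t)⌋ for all t ∈ ℕ. Then c ≤ a(t) < c + 1 for all t ∈ ℕ, and for every n ∈ ℕ one has n·c − 1 < ∑_{t=0}^{n−1} ⌊a(t)⌋ ≤ n·c. (This is the key fact behind the current-capacity mechanism: when the fractional remainder of the unused capacity is carried over to the next time step, the total number of packets allowed to leave an arc during n consecutive saturated time steps deviates from n times the discretized capacity by less than 1.) -/
/-- **Current-capacity recursion.** If `a 0 = c > 0` and
`a (t+1) = c + a t − ⌊a t⌋`, then `c ≤ a t < c + 1` for all `t`, and the total number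
of packets allowed to leave during `n` consecutive saturated time steps, namely
`∑_{t<n} ⌊a t⌋`, deviates from `n·c` by less than `1`. -/
theorem current_capacity_recursion (c : ℝ) (hc : 0 < c) (a : ℕ → ℝ)
    (h0 : a 0 = c) (hrec : ∀ t : ℕ, a (t + 1) = c + a t - (⌊a t⌋ : ℝ)) :
    (∀ t : ℕ, c ≤ a t ∧ a t < c + 1) ∧
    (∀ n : ℕ, (n : ℝ) * c - 1 < ∑ t ∈ Finset.range n, (⌊a t⌋ : ℝ) ∧
      ∑ t ∈ Finset.range n, (⌊a t⌋ : ℝ) ≤ (n : ℝ) * c) := by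
  have bounds : ∀ t : ℕ, c ≤ a t ∧ a t < c + 1 := by
    intro t
    cases t with
    | zero => constructor <;> linarith
    | succ t =>
      have h₁ := Int.floor_le (a t)
      have h₂ := Int.lt_floor_add_one (a t)
      rw [hrec t]
      constructor <;> linarith
  have sum_eq : ∀ n : ℕ,
      ∑ t ∈ Finset.range n, (⌊a t⌋ : ℝ) = (n : ℝ) * c + c - a n := by
    intro n
    induction n with
    | zero => simp [h0]
    | succ n ih =>
      rw [Finset.sum_range_succ, ih, hrec n]
      push_cast
      ring
  refine ⟨bounds, fun n => ?_⟩
  obtain ⟨h₁, h₂⟩ := bounds n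
  rw [sum_eq n]
  constructor <;> linarith
end

section
/- Consider a single-arc packet routing with deterministic queuing (with transit time τ > 0, capacity ν > 0, constant κ ≥ ν + 1, time-step length α > 0 and packet size β > 0 with β ≤ α, where the total volume of packets entering in any single time step is at most ακ). Then for every commodity j and every packet index i of commodity j, setting θ := ℓ^D_{j,u}(i) and τ̂ := ⌈τ/α⌉, the waiting time q^D_j(θ) := inf{ q ≥ 0 : G⁻_j(θ + τ̂α + q) − G⁻_j(θ + τ̂α) ≥ G⁺_j(θ) − G⁻_j(θ + τ̂α) } satisfies | q^D_j(θ) − (G⁺(θ) − G⁻(θ + τ̂α))/ν | ≤ 2α + ακ/ν + β/ν; that is, the waiting time of a packet is, up to this discretization error, the total queue volume at its queue-entrance time divided by the capacity. -/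
open MeasureTheory Finset

/-- The buffer `B(t)`: packets that entered at a step `≤ t − τ̂` (i.e. `ent i + τ̂ ≤ t`)
and have not left at a step `< t`. -/
def buffer {n : ℕ} (ent lv : Fin n → ℕ) (τh t : ℕ) : Finset (Fin n) :=
  Finset.univ.filter (fun i => ent i + τh ≤ t ∧ t ≤ lv i)

/-- **Single-arc packet routing with deterministic queuing** for an arc with transit
time `τ`, capacity `ν`, inflow bound `κ` and discretization parameters `α` (time-step
length) and `β` (packet volume); `τ̂ = ⌈τ/α⌉` and `ν̂ = να/β`. The `n` packets are
indexed by `Fin n` in FIFO order, each with a commodity `com i` and an entrance step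
`entStep i ≥ 1` (monotone in the FIFO order); the total volume entering at any single
step is at most `ακ`. The current capacity `cap` satisfies `cap 1 = ν̂` and the
carry-over recursion, and at each step `t` exactly the first
`min(|B(t)|, ⌊cap t⌋)` packets of the buffer `B(t)` leave the arc. -/
structure PacketRouting (J : Type) [DecidableEq J] (τ ν κ α β : ℝ) where
  n : ℕ
  com : Fin n → J
  entStep : Fin n → ℕ
  entPos : ∀ i, 1 ≤ entStep i
  entMono : Monotone entStep
  volBound : ∀ t : ℕ,
    β * (((Finset.univ : Finset (Fin n)).filter (fun i => entStep i = t)).card : ℝ)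
      ≤ α * κ
  leaveStep : Fin n → ℕ
  leaveGe : ∀ i, entStep i + ⌈τ / α⌉₊ ≤ leaveStep i
  cap : ℕ → ℝ
  cap1 : cap 1 = ν * α / β
  capRec : ∀ t : ℕ, 1 ≤ t → cap (t + 1) =
    if ((buffer entStep leaveStep ⌈τ / α⌉₊ t).card : ℝ) ≤ cap t
    then ν * α / β
    else ν * α / β + cap t - (⌊cap t⌋ : ℝ)
  leaveSpec : ∀ t : ℕ, 1 ≤ t → ∀ i ∈ buffer entStep leaveStep ⌈τ / α⌉₊ t,
    (leaveStep i = t ↔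
      (((buffer entStep leaveStep ⌈τ / α⌉₊ t).filter (fun i' => i' < i)).card : ℤ)
        < min ((buffer entStep leaveStep ⌈τ / α⌉₊ t).card : ℤ) ⌊cap t⌋)

/-- The step function of value `(β/α)·cnt t` on each time interval `((t−1)α, tα]`
(and `0` on `(−∞, 0]`). -/
noncomputable def stepFun (α β : ℝ) (cnt : ℕ → ℕ) : ℝ → ℝ :=
  fun θ => if 0 < θ then β / α * (cnt ⌈θ / α⌉₊ : ℝ) else 0

/-- The cumulative function `θ ↦ ∫₀^θ` of a step function with per-step counts `cnt`. -/
noncomputable def cumStep (α β : ℝ) (cnt : ℕ → ℕ) (θ : ℝ) : ℝ :=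
  ∫ ξ in (0:ℝ)..θ, stepFun α β cnt ξ

variable {J : Type} [DecidableEq J] {τ ν κ α β : ℝ}

/-- Number of packets of commodity `j` entering the arc at step `t`. -/
def entCount (R : PacketRouting J τ ν κ α β) (j : J) (t : ℕ) : ℕ :=
  ((Finset.univ : Finset (Fin R.n)).filter
    (fun i => R.entStep i = t ∧ R.com i = j)).card

/-- Number of packets of commodity `j` leaving the arc at step `t`. -/
def lvCount (R : PacketRouting J τ ν κ α β) (j : J) (t : ℕ) : ℕ :=
  ((Finset.univ : Finset (Fin R.n)).filter
    (fun i => R.leaveStep i = t ∧ R.com i = j)).card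

/-- Total number of packets entering the arc at step `t`. -/
def entCountTot (R : PacketRouting J τ ν κ α β) (t : ℕ) : ℕ :=
  ((Finset.univ : Finset (Fin R.n)).filter (fun i => R.entStep i = t)).card

/-- Total number of packets leaving the arc at step `t`. -/
def lvCountTot (R : PacketRouting J τ ν κ α β) (t : ℕ) : ℕ :=
  ((Finset.univ : Finset (Fin R.n)).filter (fun i => R.leaveStep i = t)).card

/-- Cumulative inflow `G⁺_j` of commodity `j`. -/
noncomputable def Ginj (R : PacketRouting J τ ν κ α β) (j : J) : ℝ → ℝ :=
  cumStep α β (entCount R j)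

/-- Cumulative outflow `G⁻_j` of commodity `j`. -/
noncomputable def Goutj (R : PacketRouting J τ ν κ α β) (j : J) : ℝ → ℝ :=
  cumStep α β (lvCount R j)

/-- Total cumulative inflow `G⁺`. -/
noncomputable def Gin (R : PacketRouting J τ ν κ α β) : ℝ → ℝ :=
  cumStep α β (entCountTot R)

/-- Total cumulative outflow `G⁻`. -/
noncomputable def Gout (R : PacketRouting J τ ν κ α β) : ℝ → ℝ :=
  cumStep α β (lvCountTot R)

section StepFunctions

theorem stepFun_eq_of_mem {α β : ℝ} (hα : 0 < α) (cnt : ℕ → ℕ) (m : ℕ) {ξ : ℝ}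
    (h1 : (m : ℝ) * α < ξ) (h2 : ξ ≤ (m + 1) * α) :
    stepFun α β cnt ξ = β / α * (cnt (m + 1) : ℝ) := by
  have h0 : 0 < ξ := lt_of_le_of_lt (by positivity) h1
  have hc : ⌈ξ / α⌉₊ = m + 1 := by
    rw [Nat.ceil_eq_iff (by omega)]
    refine ⟨?_, ?_⟩
    · rw [lt_div_iff₀ hα]; simpa using h1
    · rw [div_le_iff₀ hα]; push_cast; exact h2
  simp [stepFun, h0, hc]

theorem intervalIntegrable_and_integral_stepFun {α β : ℝ} (hα : 0 < α) (cnt : ℕ → ℕ) (m : ℕ)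
    {l : ℝ} (hl0 : 0 ≤ l) (hl1 : l ≤ 1) :
    IntervalIntegrable (stepFun α β cnt) volume (m * α) ((m + l) * α) ∧
      ∫ ξ in (m * α)..((m + l) * α), stepFun α β cnt ξ = β * (l * cnt (m + 1)) := by
  have hle : (m : ℝ) * α ≤ (m + l) * α := by nlinarith
  have hcongr : Set.EqOn (fun _ => β / α * (cnt (m + 1) : ℝ)) (stepFun α β cnt)
      (Set.uIoc (m * α) ((m + l) * α)) := by
    intro ξ hξ
    rw [Set.uIoc_of_le hle] at hξ
    exact (stepFun_eq_of_mem hα cnt m hξ.1 (hξ.2.trans (by nlinarith))).symm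
  refine ⟨intervalIntegrable_const.congr hcongr, ?_⟩
  rw [← intervalIntegral.integral_congr_ae (Filter.Eventually.of_forall fun ξ hξ => hcongr hξ),
    intervalIntegral.integral_const, smul_eq_mul]
  field_simp
  ring

theorem intervalIntegrable_stepFun_and_cumStep_natCast_mul {α β : ℝ} (hα : 0 < α)
    (cnt : ℕ → ℕ) (m : ℕ) :
    IntervalIntegrable (stepFun α β cnt) volume 0 (m * α) ∧
      cumStep α β cnt (m * α) = β * ((∑ k ∈ range m, cnt (k + 1) : ℕ) : ℝ) := by
  induction m with
  | zero => simp [cumStep]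
  | succ m ih =>
    obtain ⟨h1, h2⟩ := intervalIntegrable_and_integral_stepFun (β := β) hα cnt m
      zero_le_one le_rfl
    rw [Nat.cast_succ]
    refine ⟨ih.1.trans h1, ?_⟩
    have h3 := intervalIntegral.integral_add_adjacent_intervals ih.1 h1
    have h4 := ih.2
    unfold cumStep at h4 ⊢
    rw [← h3, h4, h2, sum_range_succ]
    push_cast
    ring

theorem cumStep_interpolation {α β : ℝ} (hα : 0 < α) (cnt : ℕ → ℕ) (m : ℕ)
    {l : ℝ} (hl0 : 0 ≤ l) (hl1 : l ≤ 1) :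
    cumStep α β cnt ((m + l) * α) =
      β * (((∑ k ∈ range m, cnt (k + 1) : ℕ) : ℝ) + l * cnt (m + 1)) := by
  obtain ⟨h1, h2⟩ := intervalIntegrable_and_integral_stepFun (β := β) hα cnt m hl0 hl1
  obtain ⟨h3, h4⟩ := intervalIntegrable_stepFun_and_cumStep_natCast_mul (β := β) hα cnt m
  have h5 := intervalIntegral.integral_add_adjacent_intervals h3 h1
  unfold cumStep at h4 ⊢
  rw [← h5, h4, h2]
  ring

theorem cumStep_mono {α β : ℝ} (hα : 0 < α) (hβ : 0 ≤ β) (cnt : ℕ → ℕ) {x y : ℝ}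
    (hx : 0 ≤ x) (hxy : x ≤ y) : cumStep α β cnt x ≤ cumStep α β cnt y := by
  have hint : ∀ z : ℝ, 0 ≤ z → IntervalIntegrable (stepFun α β cnt) volume 0 z := by
    intro z hz
    obtain ⟨M, hM⟩ := exists_nat_ge (z / α)
    rw [div_le_iff₀ hα] at hM
    refine (intervalIntegrable_stepFun_and_cumStep_natCast_mul hα cnt M).1.mono_set ?_
    rw [Set.uIcc_of_le hz, Set.uIcc_of_le (hz.trans hM)]
    exact Set.Icc_subset_Icc le_rfl hM
  have h := intervalIntegral.integral_interval_sub_left (hint y (hx.trans hxy)) (hint x hx)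
  have h0 : 0 ≤ ∫ ξ in x..y, stepFun α β cnt ξ := by
    refine intervalIntegral.integral_nonneg hxy fun ξ _ => ?_
    unfold stepFun
    split_ifs
    · positivity
    · exact le_rfl
  unfold cumStep
  linarith

/-- The superlevel sets of a cumulative step function start inside the time step in which the
level is crossed, and the level is attained there. -/
theorem exists_le_cumStep_iff {α β : ℝ} (hα : 0 < α) (hβ : 0 < β) (cnt : ℕ → ℕ) (m i : ℕ)
    (h1 : ∑ k ∈ range m, cnt (k + 1) < i) (h2 : i ≤ ∑ k ∈ range (m + 1), cnt (k + 1)) :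
    ∃ l : ℝ, 0 < l ∧ l ≤ 1 ∧ cumStep α β cnt ((m + l) * α) = i * β ∧
      ∀ x, 0 ≤ x → ((i : ℝ) * β ≤ cumStep α β cnt x ↔ (m + l) * α ≤ x) := by
  set C := ∑ k ∈ range m, cnt (k + 1) with hC
  rw [sum_range_succ, ← hC] at h2
  have h1' : (C : ℝ) < i := by exact_mod_cast h1
  have h2' : (i : ℝ) ≤ C + cnt (m + 1) := by exact_mod_cast h2
  have hc : (0 : ℝ) < cnt (m + 1) := by linarith
  set l : ℝ := (i - C) / cnt (m + 1) with hl
  have hlc : l * cnt (m + 1) = i - C := by rw [hl]; field_simp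
  have hl0 : 0 < l := div_pos (by linarith) hc
  have hl1 : l ≤ 1 := by rw [hl, div_le_one hc]; linarith
  have hval : cumStep α β cnt ((m + l) * α) = i * β := by
    rw [cumStep_interpolation hα cnt m hl0.le hl1, ← hC, hlc]
    ring
  refine ⟨l, hl0, hl1, hval, fun x hx => ⟨fun h => ?_, fun h => ?_⟩⟩
  · by_contra! hlt
    rcases le_total x (m * α) with hxm | hxm
    · have h3 := cumStep_mono hα hβ.le cnt hx hxm
      rw [(intervalIntegrable_stepFun_and_cumStep_natCast_mul hα cnt m).2, ← hC] at h3
      nlinarith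
    · set l' : ℝ := x / α - m with hl'
      have hx' : x = (m + l') * α := by rw [hl']; field_simp; ring
      have hl'0 : 0 ≤ l' := by
        rw [hl', sub_nonneg, le_div_iff₀ hα]; exact hxm
      have hl'l : l' < l := by
        rw [hx'] at hlt
        have := lt_of_mul_lt_mul_right hlt hα.le
        linarith
      rw [hx', cumStep_interpolation hα cnt m hl'0 (hl'l.le.trans hl1), ← hC] at h
      have h4 : l' * cnt (m + 1) < i - C := hlc ▸ mul_lt_mul_of_pos_right hl'l hc
      nlinarith
  · rw [← hval]
    exact cumStep_mono hα hβ.le cnt (by positivity) h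

end StepFunctions

section Counting

theorem sum_card_filter_eq_succ {ι : Type*} (S : Finset ι) (f : ι → ℕ) (hf : ∀ i, 1 ≤ f i)
    (m : ℕ) : ∑ k ∈ range m, #{i ∈ S | f i = k + 1} = #{i ∈ S | f i ≤ m} := by
  classical
  induction m with
  | zero =>
    have : ∀ i, f i ≠ 0 := fun i => Nat.one_le_iff_ne_zero.mp (hf i)
    simp [this]
  | succ m ih =>
    rw [sum_range_succ, ih, ← card_union_of_disjoint]
    · congr 1
      ext i
      simp only [mem_union, mem_filter]
      grind
    · rw [disjoint_filter]
      intro i _ h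
      omega

theorem card_filter_rank_lt {ι : Type*} [LinearOrder ι] (B : Finset ι) (k : ℕ) :
    #{i ∈ B | #{i' ∈ B | i' < i} < k} = min #B k := by
  induction B using Finset.induction_on_max with
  | empty => simp
  | insert a B ha ih =>
    have hnot : a ∉ B := fun h => lt_irrefl _ (ha a h)
    have hr : #{i' ∈ insert a B | i' < a} = #B := by
      congr 1
      ext x
      simp only [mem_filter, mem_insert]
      grind
    have hB : {i ∈ B | #{i' ∈ insert a B | i' < i} < k} = {i ∈ B | #{i' ∈ B | i' < i} < k} := by
      refine filter_congr fun i hi => ?_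
      rw [filter_insert, if_neg (not_lt.mpr (ha i hi).le)]
    rw [filter_insert, hB, hr, card_insert_of_notMem hnot]
    split_ifs with h
    · rw [card_insert_of_notMem (by simp [hnot]), ih]
      omega
    · rw [ih]
      omega

theorem exists_mem_card_filter_le_eq {ι : Type*} [LinearOrder ι] (S : Finset ι) (i : ℕ)
    (hi1 : 1 ≤ i) (hi : i ≤ #S) : ∃ p ∈ S, #{x ∈ S | x ≤ p} = i := by
  induction S using Finset.induction_on_max with
  | empty => simp at hi; omega
  | insert a S ha ih =>
    have hnot : a ∉ S := fun h => lt_irrefl _ (ha a h)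
    rw [card_insert_of_notMem hnot] at hi
    rcases Nat.lt_or_ge #S i with h | h
    · refine ⟨a, mem_insert_self _ _, ?_⟩
      rw [filter_true_of_mem, card_insert_of_notMem hnot]
      · omega
      · intro x hx
        rcases mem_insert.mp hx with rfl | hx
        · exact le_rfl
        · exact (ha x hx).le
    · obtain ⟨p, hp, hpi⟩ := ih h
      refine ⟨p, mem_insert_of_mem hp, ?_⟩
      rw [filter_insert, if_neg (not_le.mpr (ha p hp)), hpi]

theorem card_filter_le_lt_rank {ι : Type*} [LinearOrder ι] (S : Finset ι) {f : ι → ℕ}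
    (hf : Monotone f) {p : ι} (hp : p ∈ S) {m : ℕ} (hm : m < f p) :
    #{x ∈ S | f x ≤ m} < #{x ∈ S | x ≤ p} := by
  refine card_lt_card ((ssubset_iff_of_subset ?_).mpr ⟨p, by simp [hp], by simp [hm]⟩)
  intro x hx
  rw [mem_filter] at hx ⊢
  exact ⟨hx.1, le_of_not_ge fun h => absurd (hf h) (by omega)⟩

theorem rank_le_card_filter_le {ι : Type*} [LinearOrder ι] (S : Finset ι) {f : ι → ℕ}
    (hf : Monotone f) {p : ι} {m : ℕ} (hm : f p ≤ m) :
    #{x ∈ S | x ≤ p} ≤ #{x ∈ S | f x ≤ m} := by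
  refine card_le_card fun x hx => ?_
  rw [mem_filter] at hx ⊢
  exact ⟨hx.1, (hf hx.2).trans hm⟩

/-- The number of events up to the step in which an element's event occurs, compared with the
element's rank. -/
theorem sum_range_lt_rank_and_le {ι : Type*} [LinearOrder ι] (S : Finset ι) {f : ι → ℕ}
    (hf : Monotone f) (hf1 : ∀ i, 1 ≤ f i) {p : ι} (hp : p ∈ S) {m : ℕ} (hm : f p = m + 1) :
    ∑ k ∈ range m, #{x ∈ S | f x = k + 1} < #{x ∈ S | x ≤ p} ∧
      #{x ∈ S | x ≤ p} ≤ ∑ k ∈ range (m + 1), #{x ∈ S | f x = k + 1} := by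
  rw [sum_card_filter_eq_succ S f hf1, sum_card_filter_eq_succ S f hf1]
  exact ⟨card_filter_le_lt_rank S hf hp (by omega), rank_le_card_filter_le S hf hm.le⟩

end Counting

namespace PacketRouting

theorem entCount_eq (R : PacketRouting J τ ν κ α β) (j : J) :
    entCount R j = fun t => #{x ∈ {p | R.com p = j} | R.entStep x = t} := by
  funext t
  rw [entCount, filter_filter]
  simp only [and_comm]

theorem lvCount_eq (R : PacketRouting J τ ν κ α β) (j : J) :
    lvCount R j = fun t => #{x ∈ {p | R.com p = j} | R.leaveStep x = t} := by
  funext t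
  rw [lvCount, filter_filter]
  simp only [and_comm]

theorem one_le_leaveStep (R : PacketRouting J τ ν κ α β) (p : Fin R.n) : 1 ≤ R.leaveStep p := by
  have := R.leaveGe p
  have := R.entPos p
  omega

theorem leaveStep_mono (R : PacketRouting J τ ν κ α β) : Monotone R.leaveStep := by
  intro x y hxy
  by_contra! hlt
  have hx := R.leaveGe x
  have hy := R.leaveGe y
  have hxy' := R.entMono hxy
  have h1 := R.one_le_leaveStep y
  have hyB : y ∈ buffer R.entStep R.leaveStep ⌈τ / α⌉₊ (R.leaveStep y) := by
    simp [buffer, hy]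
  have hxB : x ∈ buffer R.entStep R.leaveStep ⌈τ / α⌉₊ (R.leaveStep y) := by
    simp only [buffer, mem_filter, mem_univ, true_and]
    omega
  have hry := (R.leaveSpec _ h1 y hyB).mp rfl
  have := (R.leaveSpec _ h1 x hxB).mpr (lt_of_le_of_lt ?_ hry)
  · omega
  · have : ∀ B : Finset (Fin R.n), #{i ∈ B | i < x} ≤ #{i ∈ B | i < y} := fun B =>
      card_le_card (monotone_filter_right B fun i _ hi => lt_of_lt_of_le hi hxy)
    exact_mod_cast this _

theorem lvCountTot_eq (R : PacketRouting J τ ν κ α β) {t : ℕ} (ht : 1 ≤ t) :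
    lvCountTot R t = min #(buffer R.entStep R.leaveStep ⌈τ / α⌉₊ t) ⌊R.cap t⌋₊ := by
  rw [← card_filter_rank_lt, lvCountTot]
  congr 1
  ext x
  simp only [mem_filter, mem_univ, true_and]
  have hrank : ∀ B : Finset (Fin R.n), x ∈ B → #{i ∈ B | i < x} < #B := fun B hx =>
    card_lt_card (filter_ssubset.mpr ⟨x, hx, lt_irrefl x⟩)
  have hfl : ∀ B : Finset (Fin R.n), x ∈ B →
      (((#{i ∈ B | i < x} : ℕ) : ℤ) < min (#B : ℤ) ⌊R.cap t⌋ ↔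
        #{i ∈ B | i < x} < ⌊R.cap t⌋₊) := by
    intro B hx
    have := hrank B hx
    rw [← Int.floor_toNat]
    omega
  constructor
  · intro h
    have hB : x ∈ buffer R.entStep R.leaveStep ⌈τ / α⌉₊ t := by
      have := R.leaveGe x
      simp only [buffer, mem_filter, mem_univ, true_and]
      omega
    exact ⟨hB, (hfl _ hB).mp ((R.leaveSpec t ht x hB).mp h)⟩
  · rintro ⟨hB, h⟩
    exact (R.leaveSpec t ht x hB).mpr ((hfl _ hB).mpr h)

theorem cap_bounds (R : PacketRouting J τ ν κ α β) (t : ℕ) :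
    ν * α / β ≤ R.cap (t + 1) ∧ R.cap (t + 1) < ν * α / β + 1 := by
  rcases t with _ | t
  · simp [R.cap1]
  · rw [R.capRec (t + 1) (by omega)]
    split_ifs
    · simp
    · have h1 := Int.floor_le (R.cap (t + 1))
      have h2 := Int.lt_floor_add_one (R.cap (t + 1))
      constructor <;> linarith

theorem lvCountTot_le_cap (hν : 0 < ν) (hα : 0 < α) (hβ : 0 < β)
    (R : PacketRouting J τ ν κ α β) (t : ℕ) : (lvCountTot R (t + 1) : ℝ) ≤ R.cap (t + 1) := by
  rw [R.lvCountTot_eq (by omega)]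
  have h0 : 0 ≤ R.cap (t + 1) := le_trans (by positivity) (R.cap_bounds t).1
  exact le_trans (by exact_mod_cast min_le_right _ _) (Nat.floor_le h0)

/-- While a packet is held back in the buffer, the outflow uses the full capacity. -/
theorem lvCountTot_of_waiting (hν : 0 < ν) (hα : 0 < α) (hβ : 0 < β)
    (R : PacketRouting J τ ν κ α β) (p : Fin R.n) {t : ℕ}
    (h1 : R.entStep p + ⌈τ / α⌉₊ ≤ t + 1) (h2 : t + 1 < R.leaveStep p) :
    (lvCountTot R (t + 1) : ℝ) = ν * α / β + R.cap (t + 1) - R.cap (t + 2) := by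
  have h0 : 0 ≤ R.cap (t + 1) := le_trans (by positivity) (R.cap_bounds t).1
  have hB : p ∈ buffer R.entStep R.leaveStep ⌈τ / α⌉₊ (t + 1) := by
    simp only [buffer, mem_filter, mem_univ, true_and]
    omega
  have hspec := (R.leaveSpec (t + 1) (by omega) p hB).not.mp (by omega)
  have hrank : ∀ B : Finset (Fin R.n), p ∈ B → #{i ∈ B | i < p} < #B := fun B hx =>
    card_lt_card (filter_ssubset.mpr ⟨p, hx, lt_irrefl p⟩)
  have hr := hrank _ hB
  have hfl : ⌊R.cap (t + 1)⌋ < #(buffer R.entStep R.leaveStep ⌈τ / α⌉₊ (t + 1)) := by omega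
  have hlt : R.cap (t + 1) < #(buffer R.entStep R.leaveStep ⌈τ / α⌉₊ (t + 1)) := by
    exact_mod_cast Int.floor_lt.mp hfl
  rw [R.capRec (t + 1) (by omega), if_neg (not_le.mpr hlt), R.lvCountTot_eq (by omega),
    min_eq_right (Nat.floor_le_of_le hlt.le), natCast_floor_eq_intCast_floor h0]
  ring

/-- The cumulative outflow during the steps in which a packet is held back in the buffer. -/
theorem sum_lvCountTot_of_waiting (hν : 0 < ν) (hα : 0 < α) (hβ : 0 < β)
    (R : PacketRouting J τ ν κ α β) (p : Fin R.n) {s : ℕ}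
    (h1 : R.entStep p + ⌈τ / α⌉₊ = s + 1) (d : ℕ) (h2 : s + 1 + d ≤ R.leaveStep p) :
    ((∑ k ∈ range (s + d), lvCountTot R (k + 1) : ℕ) : ℝ) =
      (∑ k ∈ range s, lvCountTot R (k + 1) : ℕ) + d * (ν * α / β) +
        R.cap (s + 1) - R.cap (s + d + 1) := by
  induction d with
  | zero => simp
  | succ d ih =>
    have h3 := R.lvCountTot_of_waiting hν hα hβ p (t := s + d) (by omega) (by omega)
    rw [← add_assoc, sum_range_succ, Nat.cast_add, ih (by omega), h3]
    push_cast
    ring_nf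

end PacketRouting

/-- **Lemma 5.2.** In a single-arc packet routing with deterministic queuing, for every
commodity `j` and every packet index `i` of commodity `j` with refined entrance time
`θ = ℓ^D_{j,u}(i)`, the waiting time
`q = inf{q ≥ 0 : G⁻_j(θ + τ̂α + q) − G⁻_j(θ + τ̂α) ≥ G⁺_j(θ) − G⁻_j(θ + τ̂α)}`
deviates from the total queue volume divided by the capacity,
`(G⁺(θ) − G⁻(θ + τ̂α))/ν`, by at most `2α + ακ/ν + β/ν`. -/
theorem waiting_time_eq_queue_per_capacity {J : Type} [DecidableEq J]
    (τ ν κ α β : ℝ) (hτ : 0 < τ) (hν : 0 < ν) (hκ : ν + 1 ≤ κ)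
    (hα : 0 < α) (hβ : 0 < β) (hβα : β ≤ α)
    (R : PacketRouting J τ ν κ α β) (j : J) (i : ℕ) (hi1 : 1 ≤ i)
    (hiN : i ≤ ((Finset.univ : Finset (Fin R.n)).filter (fun p => R.com p = j)).card)
    (θ T q : ℝ)
    (hθ : θ = sInf {x : ℝ | 0 ≤ x ∧ (i : ℝ) * β ≤ Ginj R j x})
    (hT : T = θ + (⌈τ / α⌉₊ : ℝ) * α)
    (hq : q = sInf {x : ℝ | 0 ≤ x ∧
      Ginj R j θ - Goutj R j T ≤ Goutj R j (T + x) - Goutj R j T}) :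
    |q - (Gin R θ - Gout R T) / ν| ≤ 2 * α + α * κ / ν + β / ν := by
  obtain ⟨p, hpj, hpi⟩ := exists_mem_card_filter_le_eq _ i hi1 hiN
  have hent := R.entPos p
  have hlv := R.leaveGe p
  obtain ⟨t, ht⟩ : ∃ t, R.entStep p = t + 1 := ⟨R.entStep p - 1, by omega⟩
  obtain ⟨d, hd⟩ : ∃ d, R.leaveStep p = t + ⌈τ / α⌉₊ + d + 1 :=
    ⟨R.leaveStep p - (t + ⌈τ / α⌉₊ + 1), by omega⟩
  set s := t + ⌈τ / α⌉₊ with hs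
  -- refined entrance and departure times of the packet
  have hEj := sum_range_lt_rank_and_le _ R.entMono R.entPos hpj ht
  have hLj := sum_range_lt_rank_and_le _ R.leaveStep_mono R.one_le_leaveStep hpj hd
  rw [hpi] at hEj hLj
  obtain ⟨l, hl0, hl1, hlval, hliff⟩ := exists_le_cumStep_iff hα hβ (entCount R j) t i
    (by rw [R.entCount_eq]; exact hEj.1) (by rw [R.entCount_eq]; exact hEj.2)
  obtain ⟨u, hu0, hu1, -, huiff⟩ := exists_le_cumStep_iff hα hβ (lvCount R j) (s + d) i
    (by rw [R.lvCount_eq]; exact hLj.1) (by rw [R.lvCount_eq]; exact hLj.2)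
  have hθ' : θ = (t + l) * α := by
    have hset : {x : ℝ | 0 ≤ x ∧ (i : ℝ) * β ≤ Ginj R j x} = Set.Ici ((t + l) * α) := by
      ext x
      have hnn : 0 ≤ (t + l) * α := by positivity
      exact ⟨fun h => (hliff x h.1).mp h.2, fun h => ⟨hnn.trans h, (hliff x (hnn.trans h)).mpr h⟩⟩
    rw [hθ, hset, csInf_Ici]
  have hT' : T = (s + l) * α := by
    rw [hT, hθ', hs]
    push_cast
    ring
  have hT0 : 0 ≤ T := by rw [hT']; positivity
  have hq' : q = max 0 ((((s + d : ℕ) : ℝ) + u) * α - T) := by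
    have hset : {x : ℝ | 0 ≤ x ∧ Ginj R j θ - Goutj R j T ≤ Goutj R j (T + x) - Goutj R j T} =
        Set.Ici (max 0 ((((s + d : ℕ) : ℝ) + u) * α - T)) := by
      have hG : Ginj R j θ = i * β := hθ' ▸ hlval
      ext x
      rw [Set.mem_Ici, max_le_iff, Set.mem_ofPred_eq, hG, sub_le_sub_iff_right, sub_le_iff_le_add']
      exact and_congr_right fun hx => huiff (T + x) (by positivity)
    rw [hq, hset, csInf_Ici]
  -- total volumes
  have hE := sum_range_lt_rank_and_le univ R.entMono R.entPos (mem_univ p) ht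
  have hL := sum_range_lt_rank_and_le univ R.leaveStep_mono R.one_le_leaveStep (mem_univ p) hd
  set N := #{x ∈ (univ : Finset (Fin R.n)) | x ≤ p}
  change ∑ k ∈ range t, entCountTot R (k + 1) < N ∧
    N ≤ ∑ k ∈ range (t + 1), entCountTot R (k + 1) at hE
  change ∑ k ∈ range (s + d), lvCountTot R (k + 1) < N ∧
    N ≤ ∑ k ∈ range (s + d + 1), lvCountTot R (k + 1) at hL
  have hGin : Gin R θ = _ := hθ' ▸ cumStep_interpolation hα (entCountTot R) t hl0.le hl1
  have hGout : Gout R T = _ := hT' ▸ cumStep_interpolation hα (lvCountTot R) s hl0.le hl1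
  have hsum := R.sum_lvCountTot_of_waiting hν hα hβ p (s := s) (by omega) d (by omega)
  have hvol : β * (entCountTot R (t + 1) : ℝ) ≤ α * κ := R.volBound (t + 1)
  have hlS := R.lvCountTot_le_cap hν hα hβ s
  have hlR := R.lvCountTot_le_cap hν hα hβ (s + d)
  have hcS := R.cap_bounds s
  have hcR := R.cap_bounds (s + d)
  rw [sum_range_succ] at hE hL
  have hE1 : ((∑ k ∈ range t, entCountTot R (k + 1) : ℕ) : ℝ) + 1 ≤ N := by exact_mod_cast hE.1
  have hE2 : (N : ℝ) ≤ (∑ k ∈ range t, entCountTot R (k + 1) : ℕ) + entCountTot R (t + 1) := by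
    exact_mod_cast hE.2
  have hL1 : ((∑ k ∈ range (s + d), lvCountTot R (k + 1) : ℕ) : ℝ) + 1 ≤ N := by
    exact_mod_cast hL.1
  have hL2 : (N : ℝ) ≤ (∑ k ∈ range (s + d), lvCountTot R (k + 1) : ℕ) +
      lvCountTot R (s + d + 1) := by
    exact_mod_cast hL.2
  generalize ((∑ k ∈ range t, entCountTot R (k + 1) : ℕ) : ℝ) = E at *
  generalize ((∑ k ∈ range s, lvCountTot R (k + 1) : ℕ) : ℝ) = L at *
  have he0 : (0 : ℝ) ≤ entCountTot R (t + 1) := Nat.cast_nonneg _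
  have hs0 : (0 : ℝ) ≤ lvCountTot R (s + 1) := Nat.cast_nonneg _
  generalize (entCountTot R (t + 1) : ℝ) = e at *
  generalize (lvCountTot R (s + 1) : ℝ) = f at *
  have hle : l * e ≤ e := mul_le_of_le_one_left he0 hl1
  have hle0 : 0 ≤ l * e := by positivity
  have hlf : l * f ≤ f := mul_le_of_le_one_left hs0 hl1
  have hlf0 : 0 ≤ l * f := by positivity
  have hlow : ((d : ℝ) - 1) * (ν * α / β) - e ≤ E + l * e - (L + l * f) := by linarith
  have hupp : E + l * e - (L + l * f) ≤ ((d : ℝ) + 1) * (ν * α / β) + 1 + e := by linarith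
  have hscale : (Gin R θ - Gout R T) / ν = β / ν * (E + l * e - (L + l * f)) := by
    rw [hGin, hGout]
    ring
  have hβν : 0 ≤ β / ν := by positivity
  have hlow' := mul_le_mul_of_nonneg_left hlow hβν
  have hupp' := mul_le_mul_of_nonneg_left hupp hβν
  have he : β / ν * e ≤ α * κ / ν := by
    rw [div_mul_eq_mul_div]
    exact div_le_div_of_nonneg_right hvol hν.le
  have hcap : β / ν * (ν * α / β) = α := by field_simp
  have hcapL : β / ν * (((d : ℝ) - 1) * (ν * α / β) - e) = (d - 1) * α - β / ν * e := by
    linear_combination ((d : ℝ) - 1) * hcap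
  have hcapU : β / ν * (((d : ℝ) + 1) * (ν * α / β) + 1 + e) =
      (d + 1) * α + β / ν + β / ν * e := by
    linear_combination ((d : ℝ) + 1) * hcap
  have hdiff : (((s + d : ℕ) : ℝ) + u) * α - T = (d + u - l) * α := by
    rw [hT']
    push_cast
    ring
  have hqlow : ((d : ℝ) - 1) * α ≤ q := by
    rw [hq', hdiff]
    exact le_max_of_le_right (mul_le_mul_of_nonneg_right (by linarith) hα.le)
  have hqupp : q ≤ ((d : ℝ) + 1) * α := by
    rw [hq', hdiff]
    exact max_le (by positivity) (mul_le_mul_of_nonneg_right (by linarith) hα.le)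
  rw [hscale, abs_le]
  constructor <;> linarith
end

section
/- In the multi-commodity single-arc comparison setting, suppose that for every j' ∈ J and every ψ ∈ βℕ with ψ ≤ β⌊m_{j'}/β⌋ such that ℓ_{j'}(ψ) ≤ θ or k_{j'}(ψ) ≤ ζ, one has |ℓ_{j'}(ψ) − k_{j'}(ψ)| ≤ δ. Then the total cumulative inflows at the respective entrance times of particle φ are close: |F(θ) − H(ζ)| ≤ 3κδ. (Claim 1 in the proof of Lemma 5.3.) -/
open MeasureTheory

theorem hitting_set_isClosed {g : ℝ → ℝ} (hg : ContinuousOn g (Set.Ici 0)) (ψ : ℝ) :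
    IsClosed {x : ℝ | 0 ≤ x ∧ ψ ≤ g x} :=
  hg.preimage_isClosed_of_isClosed isClosed_Ici isClosed_Ici

theorem hitting_time_nonneg (g : ℝ → ℝ) (ψ : ℝ) : 0 ≤ sInf {x : ℝ | 0 ≤ x ∧ ψ ≤ g x} :=
  Real.sInf_nonneg fun _ hx => hx.1

theorem hitting_time_le {g : ℝ → ℝ} {ψ x : ℝ} (hx : 0 ≤ x) (hψ : ψ ≤ g x) :
    sInf {x : ℝ | 0 ≤ x ∧ ψ ≤ g x} ≤ x :=
  csInf_le ⟨0, fun _ hy => hy.1⟩ ⟨hx, hψ⟩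

/-- A continuous nondecreasing function that reaches level `ψ` has reached it at every time
from its hitting time onwards. -/
theorem le_of_hitting_time_le {g : ℝ → ℝ} (hg : ContinuousOn g (Set.Ici 0))
    (hmono : MonotoneOn g (Set.Ici 0)) {ψ x : ℝ} (hne : ∃ y, 0 ≤ y ∧ ψ ≤ g y)
    (hx : sInf {x : ℝ | 0 ≤ x ∧ ψ ≤ g x} ≤ x) : ψ ≤ g x := by
  have hmem := (hitting_set_isClosed hg ψ).csInf_mem hne ⟨0, fun _ hy => hy.1⟩
  exact hmem.2.trans (hmono hmem.1 (hmem.1.trans hx) hx)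

theorem le_of_eventually_eq {f : ℝ → ℝ} (hmono : MonotoneOn f (Set.Ici 0)) {c x : ℝ}
    (hev : ∃ Θ : ℝ, 0 ≤ Θ ∧ ∀ x : ℝ, Θ ≤ x → f x = c) (hx : 0 ≤ x) : f x ≤ c := by
  obtain ⟨Θ, _, h⟩ := hev
  rw [← h _ (le_max_right x Θ)]
  exact hmono hx (hx.trans (le_max_left x Θ)) (le_max_left x Θ)

/-- If every packet that entered under `f` by time `θ` enters under `g` at most `δ` later, then
`g (θ + δ)` falls short of `f θ` by at most one packet. -/
theorem le_add_packet_of_hitting_times_close {f g : ℝ → ℝ} {m β δ θ : ℝ} (hβ : 0 < β)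
    (hδ : 0 < δ) (hθ : 0 ≤ θ) (hf0 : 0 ≤ f θ) (hfm : f θ ≤ m)
    (hg : ContinuousOn g (Set.Ici 0)) (hmono : MonotoneOn g (Set.Ici 0))
    (hgnn : ∀ x : ℝ, 0 ≤ x → 0 ≤ g x) (hreach : ∃ y, 0 ≤ y ∧ β * (⌊m / β⌋₊ : ℝ) ≤ g y)
    (hclose : ∀ q : ℕ, 1 ≤ q → β * (q : ℝ) ≤ β * (⌊m / β⌋₊ : ℝ) →
      sInf {x : ℝ | 0 ≤ x ∧ β * (q : ℝ) ≤ f x} ≤ θ →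
      |sInf {x : ℝ | 0 ≤ x ∧ β * (q : ℝ) ≤ f x} - sInf {x : ℝ | 0 ≤ x ∧ β * (q : ℝ) ≤ g x}| ≤ δ) :
    f θ ≤ g (θ + δ) + β := by
  set q := ⌊f θ / β⌋₊ with hq
  have hlt : f θ < β * q + β := by
    have := (div_lt_iff₀ hβ).1 (Nat.lt_floor_add_one (f θ / β))
    linarith
  have hle : β * q ≤ f θ := by
    have := (le_div_iff₀ hβ).1 (Nat.floor_le (div_nonneg hf0 hβ.le))
    linarith
  suffices β * (q : ℝ) ≤ g (θ + δ) by linarith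
  rcases Nat.eq_zero_or_pos q with h0 | hpos
  · simpa [h0] using hgnn _ (by linarith)
  · have hqm : β * (q : ℝ) ≤ β * (⌊m / β⌋₊ : ℝ) := by
      have : q ≤ ⌊m / β⌋₊ := Nat.floor_le_floor (by gcongr)
      gcongr
    have hhit := hitting_time_le hθ hle
    have habs := (abs_le.1 (hclose q hpos hqm hhit)).1
    obtain ⟨y, hy, hy'⟩ := hreach
    exact le_of_hitting_time_le hg hmono ⟨y, hy, hqm.trans hy'⟩ (by linarith)

/-- Summing the packet-wise comparison over all commodities, and moving from `θ + δ` to `ζ` by the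
Lipschitz bound on the total. -/
theorem sum_sub_sum_le_of_close {J : Type*} [Fintype J] {f g : J → ℝ → ℝ} {κ α β δ θ ζ : ℝ}
    (hκ : 0 ≤ κ) (hδ : 0 ≤ δ) (hαδ : α ≤ δ) (hJβ : (Fintype.card J : ℝ) * β ≤ κ * α)
    (hθ : 0 ≤ θ) (hζ : 0 ≤ ζ) (hθζ : |θ - ζ| ≤ δ)
    (hlip : ∀ a b : ℝ, 0 ≤ a → 0 ≤ b → |(∑ j, g j a) - (∑ j, g j b)| ≤ κ * |a - b|)
    (hle : ∀ j, f j θ ≤ g j (θ + δ) + β) :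
    (∑ j, f j θ) - (∑ j, g j ζ) ≤ 3 * κ * δ := by
  have hsum : ∑ j, f j θ ≤ (∑ j, g j (θ + δ)) + Fintype.card J * β := by
    simpa [Finset.sum_add_distrib] using Finset.sum_le_sum fun j (_ : j ∈ Finset.univ) => hle j
  have hg := (le_abs_self _).trans (hlip (θ + δ) ζ (by linarith) hζ)
  have habs : |θ + δ - ζ| ≤ 2 * δ := by
    rw [abs_le] at hθζ ⊢
    constructor <;> linarith [hθζ.1, hθζ.2]
  have h₁ := mul_le_mul_of_nonneg_left habs hκ
  have h₂ := mul_le_mul_of_nonneg_left hαδ hκ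
  linarith

/-- **Claim 1 in the proof of Lemma 5.3.** In the multi-commodity single-arc comparison
setting, if for every commodity `j'` and every packet particle `ψ ∈ βℕ` (with
`ψ ≤ β⌊m_{j'}/β⌋`) whose entrance time in one of the two flows is at most `θ` resp. `ζ`
the entrance times differ by at most `δ`, then the total cumulative inflows at the
respective entrance times of particle `φ` are close: `|F(θ) − H(ζ)| ≤ 3κδ`. -/
theorem cumulative_inflows_close {J : Type} [Fintype J]
    (τ ν κ α β δ : ℝ) (hτ : 0 < τ) (hν : 0 < ν) (hκ : ν + 1 ≤ κ)
    (hα : 0 < α) (hβ : 0 < β) (hδ : 0 < δ) (hαδ : α ≤ δ)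
    (hJβ : (Fintype.card J : ℝ) * β ≤ κ * α)
    (F H : J → ℝ → ℝ) (m : J → ℝ) (hm : ∀ j, 0 < m j)
    (hFcont : ∀ j, ContinuousOn (F j) (Set.Ici 0))
    (hHcont : ∀ j, ContinuousOn (H j) (Set.Ici 0))
    (hFmono : ∀ j, MonotoneOn (F j) (Set.Ici 0))
    (hHmono : ∀ j, MonotoneOn (H j) (Set.Ici 0))
    (hF0 : ∀ j, F j 0 = 0) (hH0 : ∀ j, H j 0 = 0)
    (hFnn : ∀ j, ∀ x : ℝ, 0 ≤ x → 0 ≤ F j x)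
    (hHnn : ∀ j, ∀ x : ℝ, 0 ≤ x → 0 ≤ H j x)
    (hFlip : ∀ a b : ℝ, 0 ≤ a → 0 ≤ b →
      |(∑ j, F j a) - (∑ j, F j b)| ≤ κ * |a - b|)
    (hHlip : ∀ a b : ℝ, 0 ≤ a → 0 ≤ b →
      |(∑ j, H j a) - (∑ j, H j b)| ≤ κ * |a - b|)
    (hFev : ∀ j, ∃ Θ : ℝ, 0 ≤ Θ ∧ ∀ x : ℝ, Θ ≤ x → F j x = m j)
    (hHev : ∀ j, ∃ Θ : ℝ, 0 ≤ Θ ∧ ∀ x : ℝ, Θ ≤ x → H j x = β * (⌊m j / β⌋₊ : ℝ))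
    (hHgrid : ∀ j, ∀ t : ℕ, ∃ k : ℕ, H j ((t : ℝ) * α) = β * (k : ℝ))
    (j₀ : J) (φ : ℝ) (p : ℕ) (hp : 1 ≤ p) (hφ : φ = β * (p : ℝ))
    (hφm : φ ≤ β * (⌊m j₀ / β⌋₊ : ℝ))
    (θ ζ : ℝ)
    (hθ : θ = sInf {x : ℝ | 0 ≤ x ∧ φ ≤ F j₀ x})
    (hζ : ζ = sInf {x : ℝ | 0 ≤ x ∧ φ ≤ H j₀ x})
    (hclose : ∀ j' : J, ∀ ψ : ℝ, (∃ q : ℕ, 1 ≤ q ∧ ψ = β * (q : ℝ)) →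
      ψ ≤ β * (⌊m j' / β⌋₊ : ℝ) →
      (sInf {x : ℝ | 0 ≤ x ∧ ψ ≤ F j' x} ≤ θ ∨
        sInf {x : ℝ | 0 ≤ x ∧ ψ ≤ H j' x} ≤ ζ) →
      |sInf {x : ℝ | 0 ≤ x ∧ ψ ≤ F j' x} - sInf {x : ℝ | 0 ≤ x ∧ ψ ≤ H j' x}| ≤ δ) :
    |(∑ j, F j θ) - (∑ j, H j ζ)| ≤ 3 * κ * δ := by
  have hθ0 : 0 ≤ θ := hθ ▸ hitting_time_nonneg _ _
  have hζ0 : 0 ≤ ζ := hζ ▸ hitting_time_nonneg _ _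
  have hθζ : |θ - ζ| ≤ δ := by
    have := hclose j₀ φ ⟨p, hp, hφ⟩ hφm (Or.inl hθ.ge)
    rwa [← hθ, ← hζ] at this
  have hfloor : ∀ j, β * (⌊m j / β⌋₊ : ℝ) ≤ m j := fun j => by
    have := (le_div_iff₀ hβ).1 (Nat.floor_le (div_nonneg (hm j).le hβ.le))
    linarith
  have hκ0 : 0 ≤ κ := by linarith
  rw [abs_sub_le_iff]
  constructor
  · refine sum_sub_sum_le_of_close hκ0 hδ.le hαδ hJβ hθ0 hζ0 hθζ hHlip fun j => ?_
    obtain ⟨Θ, hΘ, hev⟩ := hHev j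
    exact le_add_packet_of_hitting_times_close hβ hδ hθ0 (hFnn j θ hθ0)
      (le_of_eventually_eq (hFmono j) (hFev j) hθ0) (hHcont j) (hHmono j) (hHnn j)
      ⟨Θ, hΘ, (hev Θ le_rfl).ge⟩
      fun q hq hqm hle => hclose j _ ⟨q, hq, rfl⟩ hqm (Or.inl hle)
  · rw [abs_sub_comm] at hθζ
    refine sum_sub_sum_le_of_close hκ0 hδ.le hαδ hJβ hζ0 hθ0 hθζ hFlip fun j => ?_
    obtain ⟨Θ, hΘ, hev⟩ := hFev j
    refine le_add_packet_of_hitting_times_close hβ hδ hζ0 (hHnn j ζ hζ0)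
      ((le_of_eventually_eq (hHmono j) (hHev j) hζ0).trans (hfloor j)) (hFcont j) (hFmono j)
      (hFnn j) ⟨Θ, hΘ, (hfloor j).trans (hev Θ le_rfl).ge⟩ fun q hq hqm hle => ?_
    rw [abs_sub_comm]
    exact hclose j _ ⟨q, hq, rfl⟩ hqm (Or.inr hle)
end

section
/- In the multi-commodity single-arc comparison setting, suppose additionally that there are nonnegative, bounded, locally integrable functions f⁺, f⁻, h⁺, h⁻ on ℝ vanishing on (−∞,0) with F(θ) = ∫₀^θ f⁺, H(θ) = ∫₀^θ h⁺, such that (f⁺, f⁻) and (h⁺, h⁻) are Vickrey queue flows for the arc; write F⁻(θ) := ∫₀^θ f⁻ and H⁻(θ) := ∫₀^θ h⁻. Suppose that for every j' ∈ J and every ψ ∈ βℕ with ψ ≤ β⌊m_{j'}/β⌋ such that ℓ_{j'}(ψ) ≤ θ + 3δ or k_{j'}(ψ) ≤ ζ + 3δ, one has |ℓ_{j'}(ψ) − k_{j'}(ψ)| ≤ δ. Then the arrival times of particle φ at the head of the arc in the two flows are close: | (θ + τ + (F(θ) − F⁻(θ + τ))/ν) − (ζ + τ + (H(ζ) − H⁻(ζ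 + τ))/ν) | ≤ 11·(κ/ν)·δ. (Lemma 5.3.) -/
open MeasureTheory

open Set in
lemma sInf_superlevel_mem {b : ℝ → ℝ} (hb : ContinuousOn b (Ici 0)) {ψ : ℝ}
    (hne : ∃ y : ℝ, 0 ≤ y ∧ ψ ≤ b y) :
    0 ≤ sInf {x : ℝ | 0 ≤ x ∧ ψ ≤ b x} ∧ ψ ≤ b (sInf {x : ℝ | 0 ≤ x ∧ ψ ≤ b x}) := by
  have hcl : IsClosed {x : ℝ | 0 ≤ x ∧ ψ ≤ b x} :=
    hb.preimage_isClosed_of_isClosed isClosed_Ici (isClosed_Ici (a := ψ))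
  exact hcl.csInf_mem hne ⟨0, fun x hx => hx.1⟩

/-- If the hitting times of the multiples of `β` up to time `x` are at most `δ` later for `b`
than for `a`, then `b` lags behind `a` by at most `β` after a delay of `δ`. -/
lemma le_delay_add_of_sInf_superlevel_le {a b : ℝ → ℝ} {β δ x : ℝ} {N : ℕ} (hβ : 0 < β)
    (hδ : 0 ≤ δ) (hx : 0 ≤ x) (hbc : ContinuousOn b (Set.Ici 0)) (hbm : MonotoneOn b (Set.Ici 0))
    (hb0 : ∀ y : ℝ, 0 ≤ y → 0 ≤ b y) (hreach : ∃ y : ℝ, 0 ≤ y ∧ β * (N : ℝ) ≤ b y)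
    (ha0 : 0 ≤ a x) (haN : a x < β * ((N : ℝ) + 1))
    (hclose : ∀ q : ℕ, 1 ≤ q → q ≤ N → sInf {y : ℝ | 0 ≤ y ∧ β * (q : ℝ) ≤ a y} ≤ x →
      sInf {y : ℝ | 0 ≤ y ∧ β * (q : ℝ) ≤ b y} ≤
        sInf {y : ℝ | 0 ≤ y ∧ β * (q : ℝ) ≤ a y} + δ) :
    a x ≤ b (x + δ) + β := by
  set q : ℕ := ⌊a x / β⌋₊ with hq
  have hq1 : β * (q : ℝ) ≤ a x := by
    have := Nat.floor_le (div_nonneg ha0 hβ.le)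
    rw [le_div_iff₀ hβ] at this
    linarith
  have hq2 : a x ≤ β * (q : ℝ) + β := by
    have := Nat.lt_floor_add_one (a x / β)
    rw [div_lt_iff₀ hβ] at this
    linarith
  have hqN : q ≤ N := by
    have h : (q : ℝ) < (N : ℝ) + 1 := by
      by_contra! h
      nlinarith [mul_le_mul_of_nonneg_left h hβ.le]
    exact Nat.lt_succ_iff.mp (by exact_mod_cast h)
  rcases Nat.eq_zero_or_pos q with h0 | hpos
  · have := hb0 (x + δ) (by linarith)
    rw [h0] at hq2
    simp only [Nat.cast_zero, mul_zero] at hq2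
    linarith
  · have hax : sInf {y : ℝ | 0 ≤ y ∧ β * (q : ℝ) ≤ a y} ≤ x :=
      csInf_le ⟨0, fun y hy => hy.1⟩ ⟨hx, hq1⟩
    have hbx := hclose q hpos hqN hax
    obtain ⟨y, hy0, hy⟩ := hreach
    have hqN' : (q : ℝ) ≤ N := by exact_mod_cast hqN
    obtain ⟨h1, h2⟩ := sInf_superlevel_mem hbc (ψ := β * (q : ℝ))
      ⟨y, hy0, (mul_le_mul_of_nonneg_left hqN' hβ.le).trans hy⟩
    have := hbm (a := sInf {y : ℝ | 0 ≤ y ∧ β * (q : ℝ) ≤ b y}) h1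
      (show x + δ ∈ Set.Ici 0 from by simp only [Set.mem_Ici]; linarith) (by linarith)
    linarith

namespace IsVickreyFlow

variable {τ ν : ℝ} {fi fo : ℝ → ℝ}

lemma intervalIntegrable_inflow (h : IsVickreyFlow τ ν fi fo) (a b : ℝ) :
    IntervalIntegrable fi volume a b :=
  (h.2.2.2.1.integrableOn_isCompact isCompact_uIcc).intervalIntegrable

lemma intervalIntegrable_outflow (h : IsVickreyFlow τ ν fi fo) (a b : ℝ) :
    IntervalIntegrable fo volume a b :=
  (h.2.2.2.2.1.integrableOn_isCompact isCompact_uIcc).intervalIntegrable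

lemma queue_nonneg (h : IsVickreyFlow τ ν fi fo) (s : ℝ) :
    0 ≤ cumul fi s - cumul fo (s + τ) := by
  simpa using h.2.2.2.2.2.2.2.1 (s + τ)

lemma outflow_le_ae (h : IsVickreyFlow τ ν fi fo) : ∀ᵐ x : ℝ ∂volume, fo x ≤ ν := by
  filter_upwards [h.2.2.2.2.2.2.2.2] with x hx
  rcases (h.2.2.2.2.2.2.2.1 x).lt_or_eq with h1 | h1
  · exact (hx.1 h1).le
  · rw [hx.2 h1.symm]
    exact min_le_right _ _

lemma cumul_outflow_sub (h : IsVickreyFlow τ ν fi fo) (a b : ℝ) :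
    cumul fo b - cumul fo a = ∫ x in a..b, fo x :=
  intervalIntegral.integral_interval_sub_left (h.intervalIntegrable_outflow 0 b)
    (h.intervalIntegrable_outflow 0 a)

lemma cumul_outflow_le (h : IsVickreyFlow τ ν fi fo) {s t : ℝ} (hst : s ≤ t) :
    cumul fo (t + τ) ≤ cumul fi s + ν * (t - s) := by
  have h1 := h.cumul_outflow_sub (s + τ) (t + τ)
  have h2 : ∫ x in (s + τ)..(t + τ), fo x ≤ ∫ _ in (s + τ)..(t + τ), ν :=
    intervalIntegral.integral_mono_ae (by linarith) (h.intervalIntegrable_outflow _ _)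
      intervalIntegrable_const h.outflow_le_ae
  rw [intervalIntegral.integral_const, smul_eq_mul] at h2
  linarith [h.queue_nonneg s]

lemma continuous_queue (h : IsVickreyFlow τ ν fi fo) :
    Continuous fun s => cumul fi s - cumul fo (s + τ) := by
  have h1 : Continuous (cumul fi) :=
    intervalIntegral.continuous_primitive h.intervalIntegrable_inflow 0
  have h2 : Continuous (cumul fo) :=
    intervalIntegral.continuous_primitive h.intervalIntegrable_outflow 0
  fun_prop

/-- The cumulative outflow is attained by serving at full rate since the last time at which the
queue was empty. -/
lemma exists_cumul_outflow_eq (h : IsVickreyFlow τ ν fi fo) (hτ : 0 ≤ τ) {t : ℝ} (ht : 0 ≤ t) :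
    ∃ s, 0 ≤ s ∧ s ≤ t ∧ cumul fo (t + τ) = cumul fi s + ν * (t - s) := by
  have hcomp : IsCompact (Set.Icc 0 t ∩ {s | cumul fi s - cumul fo (s + τ) = 0}) :=
    isCompact_Icc.inter_right (isClosed_eq h.continuous_queue continuous_const)
  have hzero : cumul fi 0 - cumul fo (0 + τ) = 0 := by
    have h1 : cumul fi 0 = 0 := intervalIntegral.integral_same
    have h2 : 0 ≤ cumul fo (0 + τ) :=
      intervalIntegral.integral_nonneg (by linarith) fun x _ => h.2.1 x
    linarith [h.queue_nonneg 0]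
  obtain ⟨s, ⟨⟨hs0, hst⟩, hsz⟩, hmax⟩ := hcomp.exists_isGreatest ⟨0, ⟨le_rfl, ht⟩, hzero⟩
  refine ⟨s, hs0, hst, ?_⟩
  have h1 := h.cumul_outflow_sub (s + τ) (t + τ)
  have h2 : ∫ x in (s + τ)..(t + τ), fo x = ∫ _ in (s + τ)..(t + τ), ν := by
    refine intervalIntegral.integral_congr_ae ?_
    filter_upwards [h.2.2.2.2.2.2.2.2] with x hx hmem
    rw [Set.uIoc_of_le (by linarith)] at hmem
    refine hx.1 ((h.2.2.2.2.2.2.2.1 x).lt_of_ne fun h0 => ?_)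
    have := hmax (a := x - τ) ⟨⟨by linarith [hmem.1], by linarith [hmem.2]⟩, by
      simpa using h0.symm⟩
    linarith [hmem.1]
  rw [intervalIntegral.integral_const, smul_eq_mul] at h2
  simp only [Set.mem_ofPred_eq] at hsz
  linarith

/-- Comparison of exit times of two Vickrey flows with close cumulative inflows. -/
lemma exit_time_le {gi go : ℝ → ℝ} {κ δ a b : ℝ} (hf : IsVickreyFlow τ ν fi fo)
    (hg : IsVickreyFlow τ ν gi go) (hτ : 0 ≤ τ) (hν : 0 < ν) (hκ : ν ≤ κ) (hδ : 0 ≤ δ)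
    (hflip : ∀ x y : ℝ, 0 ≤ x → 0 ≤ y → |cumul fi x - cumul fi y| ≤ κ * |x - y|)
    (hglip : ∀ x y : ℝ, 0 ≤ x → 0 ≤ y → |cumul gi x - cumul gi y| ≤ κ * |x - y|)
    (ha : 0 ≤ a) (hb : 0 ≤ b) (hab : |a - b| ≤ δ)
    (hfg : ∀ x : ℝ, 0 ≤ x → x ≤ a → cumul fi x ≤ cumul gi (x + δ) + κ * δ)
    (hgf : ∀ x : ℝ, 0 ≤ x → x ≤ b → cumul gi x ≤ cumul fi (x + δ) + κ * δ) :
    (a + τ + (cumul fi a - cumul fo (a + τ)) / ν) -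
      (b + τ + (cumul gi b - cumul go (b + τ)) / ν) ≤ 5 * (κ / ν) * δ := by
  obtain ⟨hab1, hab2⟩ := abs_le.mp hab
  have hκ0 : 0 ≤ κ := hν.le.trans hκ
  have hκδ : 0 ≤ κ * δ := mul_nonneg hκ0 hδ
  have hνδ : ν * δ ≤ κ * δ := mul_le_mul_of_nonneg_right hκ hδ
  obtain ⟨s, hs0, hsa, hs⟩ := hf.exists_cumul_outflow_eq hτ ha
  have key : ν * (a - b) + (cumul fi a - cumul fo (a + τ)) - (cumul gi b - cumul go (b + τ))
      ≤ 5 * (κ * δ) := by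
    rcases le_total s b with hsb | hbs
    · have h1 := hg.cumul_outflow_le hsb
      have h2 := hgf s hs0 hsb
      have h3 := (abs_le.mp (hflip (s + δ) s (by linarith) hs0)).2
      rw [add_sub_cancel_left, abs_of_nonneg hδ] at h3
      have h4 := hfg a ha le_rfl
      have h5 := (abs_le.mp (hglip (a + δ) b (by linarith) hb)).2
      have h6 : κ * |a + δ - b| ≤ κ * (2 * δ) :=
        mul_le_mul_of_nonneg_left (abs_le.mpr ⟨by linarith, by linarith⟩) hκ0
      nlinarith
    · have h1 := hg.queue_nonneg b
      have h3 := (abs_le.mp (hflip a s ha hs0)).2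
      have h6 : κ * |a - s| ≤ κ * δ :=
        mul_le_mul_of_nonneg_left (abs_le.mpr ⟨by linarith, by linarith⟩) hκ0
      have h7 : ν * (s - b) ≤ ν * δ := mul_le_mul_of_nonneg_left (by linarith) hν.le
      nlinarith
  have hl : (a + τ + (cumul fi a - cumul fo (a + τ)) / ν) -
      (b + τ + (cumul gi b - cumul go (b + τ)) / ν) =
      (ν * (a - b) + (cumul fi a - cumul fo (a + τ)) - (cumul gi b - cumul go (b + τ))) / ν := by
    field_simp
    ring
  have hr : 5 * (κ / ν) * δ = 5 * (κ * δ) / ν := by ring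
  rw [hl, hr]
  exact div_le_div_of_nonneg_right key hν.le

end IsVickreyFlow

/-- **Lemma 5.3.** Under the hypotheses of the multi-commodity single-arc comparison
setting (with the entrance-time closeness assumption up to `θ + 3δ` resp. `ζ + 3δ`),
the arrival times of particle `φ` at the head of the arc in the two flows are close:
`|T(θ) − T^H(ζ)| ≤ 11·(κ/ν)·δ`, where the exit time of a particle entering at time `ϑ`
is `ϑ + τ + z(ϑ + τ)/ν`. -/
theorem stmt_10_thm {J : Type} [Fintype J]
    (τ ν κ α β δ : ℝ) (hτ : 0 < τ) (hν : 0 < ν) (hκ : ν + 1 ≤ κ)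
    (hα : 0 < α) (hβ : 0 < β) (hδ : 0 < δ) (hαδ : α ≤ δ)
    (hJβ : (Fintype.card J : ℝ) * β ≤ κ * α)
    (F H : J → ℝ → ℝ) (m : J → ℝ) (hm : ∀ j, 0 < m j)
    (hFcont : ∀ j, ContinuousOn (F j) (Set.Ici 0))
    (hHcont : ∀ j, ContinuousOn (H j) (Set.Ici 0))
    (hFmono : ∀ j, MonotoneOn (F j) (Set.Ici 0))
    (hHmono : ∀ j, MonotoneOn (H j) (Set.Ici 0))
    (hF0 : ∀ j, F j 0 = 0) (hH0 : ∀ j, H j 0 = 0)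
    (hFnn : ∀ j, ∀ x : ℝ, 0 ≤ x → 0 ≤ F j x)
    (hHnn : ∀ j, ∀ x : ℝ, 0 ≤ x → 0 ≤ H j x)
    (hFlip : ∀ a b : ℝ, 0 ≤ a → 0 ≤ b →
      |(∑ j, F j a) - (∑ j, F j b)| ≤ κ * |a - b|)
    (hHlip : ∀ a b : ℝ, 0 ≤ a → 0 ≤ b →
      |(∑ j, H j a) - (∑ j, H j b)| ≤ κ * |a - b|)
    (hFev : ∀ j, ∃ Θ : ℝ, 0 ≤ Θ ∧ ∀ x : ℝ, Θ ≤ x → F j x = m j)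
    (hHev : ∀ j, ∃ Θ : ℝ, 0 ≤ Θ ∧ ∀ x : ℝ, Θ ≤ x → H j x = β * (⌊m j / β⌋₊ : ℝ))
    (hHgrid : ∀ j, ∀ t : ℕ, ∃ k : ℕ, H j ((t : ℝ) * α) = β * (k : ℝ))
    (fp fm hp hm' : ℝ → ℝ)
    (hVF : IsVickreyFlow τ ν fp fm) (hVH : IsVickreyFlow τ ν hp hm')
    (hFf : ∀ x : ℝ, 0 ≤ x → (∑ j, F j x) = cumul fp x)
    (hHh : ∀ x : ℝ, 0 ≤ x → (∑ j, H j x) = cumul hp x)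
    (j₀ : J) (φ : ℝ) (p : ℕ) (hp1 : 1 ≤ p) (hφ : φ = β * (p : ℝ))
    (hφm : φ ≤ β * (⌊m j₀ / β⌋₊ : ℝ))
    (θ ζ : ℝ)
    (hθ : θ = sInf {x : ℝ | 0 ≤ x ∧ φ ≤ F j₀ x})
    (hζ : ζ = sInf {x : ℝ | 0 ≤ x ∧ φ ≤ H j₀ x})
    (hclose : ∀ j' : J, ∀ ψ : ℝ, (∃ q : ℕ, 1 ≤ q ∧ ψ = β * (q : ℝ)) →
      ψ ≤ β * (⌊m j' / β⌋₊ : ℝ) →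
      (sInf {x : ℝ | 0 ≤ x ∧ ψ ≤ F j' x} ≤ θ + 3 * δ ∨
        sInf {x : ℝ | 0 ≤ x ∧ ψ ≤ H j' x} ≤ ζ + 3 * δ) →
      |sInf {x : ℝ | 0 ≤ x ∧ ψ ≤ F j' x} - sInf {x : ℝ | 0 ≤ x ∧ ψ ≤ H j' x}| ≤ δ) :
    |(θ + τ + ((∑ j, F j θ) - cumul fm (θ + τ)) / ν) -
      (ζ + τ + ((∑ j, H j ζ) - cumul hm' (ζ + τ)) / ν)| ≤ 11 * (κ / ν) * δ := by
  classical
  have hκ0 : 0 ≤ κ := by linarith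
  have hFle : ∀ j, ∀ x : ℝ, 0 ≤ x → F j x ≤ m j := fun j x hx => by
    obtain ⟨Θ, hΘ, h⟩ := hFev j
    rw [← h (max x Θ) (le_max_right _ _)]
    exact hFmono j hx (hx.trans (le_max_left _ _)) (le_max_left _ _)
  have hHle : ∀ j, ∀ x : ℝ, 0 ≤ x → H j x ≤ β * (⌊m j / β⌋₊ : ℝ) := fun j x hx => by
    obtain ⟨Θ, hΘ, h⟩ := hHev j
    rw [← h (max x Θ) (le_max_right _ _)]
    exact hHmono j hx (hx.trans (le_max_left _ _)) (le_max_left _ _)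
  have hfloor : ∀ j, β * (⌊m j / β⌋₊ : ℝ) ≤ m j ∧ m j < β * ((⌊m j / β⌋₊ : ℝ) + 1) :=
    fun j => by
      have h1 := Nat.floor_le (div_nonneg (hm j).le hβ.le)
      have h2 := Nat.lt_floor_add_one (m j / β)
      rw [le_div_iff₀ hβ] at h1
      rw [div_lt_iff₀ hβ] at h2
      constructor <;> linarith
  have hFreach : ∀ j, ∃ y : ℝ, 0 ≤ y ∧ β * (⌊m j / β⌋₊ : ℝ) ≤ F j y := fun j => by
    obtain ⟨Θ, hΘ, h⟩ := hFev j
    exact ⟨Θ, hΘ, by rw [h Θ le_rfl]; exact (hfloor j).1⟩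
  have hHreach : ∀ j, ∃ y : ℝ, 0 ≤ y ∧ β * (⌊m j / β⌋₊ : ℝ) ≤ H j y := fun j => by
    obtain ⟨Θ, hΘ, h⟩ := hHev j
    exact ⟨Θ, hΘ, by rw [h Θ le_rfl]⟩
  have hclose' : ∀ j, ∀ q : ℕ, 1 ≤ q → q ≤ ⌊m j / β⌋₊ → _ := fun j q hq hqN =>
    hclose j (β * (q : ℝ)) ⟨q, hq, rfl⟩
      (mul_le_mul_of_nonneg_left (by exact_mod_cast hqN) hβ.le)
  have hθ0 : 0 ≤ θ := hθ ▸ Real.sInf_nonneg fun x hx => hx.1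
  have hζ0 : 0 ≤ ζ := hζ ▸ Real.sInf_nonneg fun x hx => hx.1
  have hθζ : |θ - ζ| ≤ δ := by
    have := hclose j₀ φ ⟨p, hp1, hφ⟩ hφm (Or.inl (by rw [← hθ]; linarith))
    rwa [← hθ, ← hζ] at this
  have hcard : ∑ _j : J, β ≤ κ * δ := by
    rw [Finset.sum_const, nsmul_eq_mul, Finset.card_univ]
    exact hJβ.trans (mul_le_mul_of_nonneg_left hαδ hκ0)
  have hFH : ∀ x : ℝ, 0 ≤ x → x ≤ θ → cumul fp x ≤ cumul hp (x + δ) + κ * δ := by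
    intro x hx hxθ
    rw [← hFf x hx, ← hHh (x + δ) (by linarith)]
    have hsum : ∑ j, F j x ≤ ∑ j, (H j (x + δ) + β) := Finset.sum_le_sum fun j _ =>
      le_delay_add_of_sInf_superlevel_le hβ hδ.le hx (hHcont j) (hHmono j) (hHnn j) (hHreach j)
        (hFnn j x hx) ((hFle j x hx).trans_lt (hfloor j).2) fun q hq hqN hqx => by
          linarith [(abs_le.mp (hclose' j q hq hqN (Or.inl (by linarith)))).1]
    rw [Finset.sum_add_distrib] at hsum
    linarith
  have hHF : ∀ x : ℝ, 0 ≤ x → x ≤ ζ → cumul hp x ≤ cumul fp (x + δ) + κ * δ := by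
    intro x hx hxζ
    rw [← hHh x hx, ← hFf (x + δ) (by linarith)]
    have hsum : ∑ j, H j x ≤ ∑ j, (F j (x + δ) + β) := Finset.sum_le_sum fun j _ =>
      le_delay_add_of_sInf_superlevel_le hβ hδ.le hx (hFcont j) (hFmono j) (hFnn j) (hFreach j)
        (hHnn j x hx) ((hHle j x hx).trans_lt (by linarith)) fun q hq hqN hqx => by
          linarith [(abs_le.mp (hclose' j q hq hqN (Or.inr (by linarith)))).2]
    rw [Finset.sum_add_distrib] at hsum
    linarith
  have hflip : ∀ x y : ℝ, 0 ≤ x → 0 ≤ y → |cumul fp x - cumul fp y| ≤ κ * |x - y| :=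
    fun x y hx hy => by rw [← hFf x hx, ← hFf y hy]; exact hFlip x y hx hy
  have hhlip : ∀ x y : ℝ, 0 ≤ x → 0 ≤ y → |cumul hp x - cumul hp y| ≤ κ * |x - y| :=
    fun x y hx hy => by rw [← hHh x hx, ← hHh y hy]; exact hHlip x y hx hy
  have h1 := hVF.exit_time_le hVH hτ.le hν (by linarith) hδ.le hflip hhlip hθ0 hζ0 hθζ hFH hHF
  have h2 := hVH.exit_time_le hVF hτ.le hν (by linarith) hδ.le hhlip hflip hζ0 hθ0
    (abs_sub_comm θ ζ ▸ hθζ) hHF hFH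
  have hpos : 0 ≤ κ / ν * δ := mul_nonneg (div_nonneg hκ0 hν.le) hδ.le
  rw [hFf θ hθ0, hHh ζ hζ0]
  exact abs_le.mpr ⟨by linarith, by linarith⟩
end

section
/- Let κ, β, m > 0 and ε ≥ β, and set N := ⌊m/β⌋. Let F, G : [0, ∞) → [0, ∞) be nondecreasing, κ-Lipschitz functions with F(0) = G(0) = 0 such that F(θ) ≤ m and G(θ) ≤ Nβ for all θ, F is eventually constant with value m, and G is eventually constant with value Nβ. Suppose that for every i ∈ {1, …, N} the hitting times satisfy | inf{θ ≥ 0 : F(θ) ≥ iβ} − inf{θ ≥ 0 : G(θ) ≥ iβ} | ≤ (ε − β)/κ. Then |F(θ) − G(θ)| ≤ ε for all θ ≥ 0. (This is the core of Theorem 5.5(2): if the arrival times of every packet of the packet routing and of the corresponding particle of the flow over time differ by at most (ε−β)/κ, then the cumulative flow of the packet model is uniformly within ε of the cumulative flow of the flow over time model.) -/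
/-- If `G` is nondecreasing and `κ`-Lipschitz, and `G` reaches each level `iβ` that `F` reaches,
at most `(ε - β) / κ` later, then `F` exceeds `G` by at most `ε`. -/
theorem sub_le_of_hitting_time_le {κ β ε : ℝ} (hκ : 0 < κ) (hβ : 0 < β) (hε : β ≤ ε)
    {F G : ℝ → ℝ}
    (hGmono : ∀ a b : ℝ, 0 ≤ a → a ≤ b → G a ≤ G b)
    (hGlip : ∀ a b : ℝ, 0 ≤ a → 0 ≤ b → |G a - G b| ≤ κ * |a - b|)
    {θ : ℝ} (hθ : 0 ≤ θ) (hFnn : 0 ≤ F θ) (hGnn : 0 ≤ G θ)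
    (hne : ∀ i : ℕ, (i : ℝ) * β ≤ F θ → ∃ x : ℝ, 0 ≤ x ∧ (i : ℝ) * β ≤ G x)
    (hhit : ∀ i : ℕ, 1 ≤ i → (i : ℝ) * β ≤ F θ →
      sInf {x : ℝ | 0 ≤ x ∧ (i : ℝ) * β ≤ G x} -
          sInf {x : ℝ | 0 ≤ x ∧ (i : ℝ) * β ≤ F x} ≤ (ε - β) / κ) :
    F θ - G θ ≤ ε := by
  set k := ⌊F θ / β⌋₊
  have hk : (k : ℝ) * β ≤ F θ := (le_div_iff₀ hβ).1 (Nat.floor_le (by positivity))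
  have hk' : F θ < ((k : ℝ) + 1) * β := (div_lt_iff₀ hβ).1 (Nat.lt_floor_add_one _)
  rcases Nat.eq_zero_or_pos k with h0 | hpos
  · rw [h0] at hk'
    norm_num at hk'
    linarith
  by_contra! hlt
  have hF_hit : sInf {x : ℝ | 0 ≤ x ∧ (k : ℝ) * β ≤ F x} ≤ θ :=
    csInf_le ⟨0, fun _ hx => hx.1⟩ ⟨hθ, hk⟩
  have hG_hit : θ + ((k : ℝ) * β - G θ) / κ ≤ sInf {x : ℝ | 0 ≤ x ∧ (k : ℝ) * β ≤ G x} := by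
    refine le_csInf (hne k hk) fun x hx => ?_
    have hθx : θ ≤ x := by
      by_contra! h
      linarith [hGmono x θ hx.1 h.le, hx.2]
    have hlip := (le_abs_self _).trans (hGlip x θ hx.1 hθ)
    rw [abs_of_nonneg (sub_nonneg.2 hθx)] at hlip
    have : ((k : ℝ) * β - G θ) / κ ≤ x - θ := by
      rw [div_le_iff₀ hκ]
      linarith [hx.2]
    linarith
  have hdelay : (ε - β) / κ < ((k : ℝ) * β - G θ) / κ :=
    div_lt_div_of_pos_right (by linarith) hκ
  linarith [hhit k hpos hk]

/-- **Core of Theorem 5.5(2).** Let `F, G : [0,∞) → [0,∞)` be nondecreasing,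
`κ`-Lipschitz functions with `F 0 = G 0 = 0`, `F ≤ m`, `G ≤ Nβ` (where `N = ⌊m/β⌋`),
`F` eventually constant with value `m` and `G` eventually constant with value `Nβ`.
If for every `i ∈ {1, …, N}` the hitting times of level `iβ` of `F` and `G` differ by
at most `(ε − β)/κ`, then `|F θ − G θ| ≤ ε` for all `θ ≥ 0`. -/
theorem cumulative_flows_uniformly_close
    (κ β m ε : ℝ) (hκ : 0 < κ) (hβ : 0 < β) (hm : 0 < m) (hε : β ≤ ε)
    (N : ℕ) (hN : N = ⌊m / β⌋₊)
    (F G : ℝ → ℝ)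
    (hFmono : ∀ a b : ℝ, 0 ≤ a → a ≤ b → F a ≤ F b)
    (hGmono : ∀ a b : ℝ, 0 ≤ a → a ≤ b → G a ≤ G b)
    (hFlip : ∀ a b : ℝ, 0 ≤ a → 0 ≤ b → |F a - F b| ≤ κ * |a - b|)
    (hGlip : ∀ a b : ℝ, 0 ≤ a → 0 ≤ b → |G a - G b| ≤ κ * |a - b|)
    (hF0 : F 0 = 0) (hG0 : G 0 = 0)
    (hFnn : ∀ θ : ℝ, 0 ≤ θ → 0 ≤ F θ) (hGnn : ∀ θ : ℝ, 0 ≤ θ → 0 ≤ G θ)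
    (hFub : ∀ θ : ℝ, 0 ≤ θ → F θ ≤ m)
    (hGub : ∀ θ : ℝ, 0 ≤ θ → G θ ≤ (N : ℝ) * β)
    (hFev : ∃ Θ : ℝ, 0 ≤ Θ ∧ ∀ x : ℝ, Θ ≤ x → F x = m)
    (hGev : ∃ Θ : ℝ, 0 ≤ Θ ∧ ∀ x : ℝ, Θ ≤ x → G x = (N : ℝ) * β)
    (hhit : ∀ i : ℕ, 1 ≤ i → i ≤ N →
      |sInf {θ : ℝ | 0 ≤ θ ∧ (i : ℝ) * β ≤ F θ} -
          sInf {θ : ℝ | 0 ≤ θ ∧ (i : ℝ) * β ≤ G θ}| ≤ (ε - β) / κ) :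
    ∀ θ : ℝ, 0 ≤ θ → |F θ - G θ| ≤ ε := by
  have level_le : ∀ i : ℕ, (i : ℝ) * β ≤ m → i ≤ N := fun i hi =>
    hN ▸ Nat.le_floor ((le_div_iff₀ hβ).2 hi)
  have hNm : (N : ℝ) * β ≤ m :=
    (le_div_iff₀ hβ).1 (hN ▸ Nat.floor_le (by positivity))
  obtain ⟨S, hS, hFS⟩ := hFev
  obtain ⟨T, hT, hGT⟩ := hGev
  intro θ hθ
  rw [abs_sub_le_iff]
  constructor
  · have hle : ∀ i : ℕ, (i : ℝ) * β ≤ F θ → i ≤ N := fun i hi =>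
      level_le i (hi.trans (hFub θ hθ))
    refine sub_le_of_hitting_time_le hκ hβ hε hGmono hGlip hθ (hFnn θ hθ) (hGnn θ hθ)
      (fun i hi => ⟨T, hT, ?_⟩) fun i h1 hi => (abs_sub_le_iff.1 (hhit i h1 (hle i hi))).2
    rw [hGT T le_rfl]
    have := hle i hi
    gcongr
  · have hle : ∀ i : ℕ, (i : ℝ) * β ≤ G θ → (i : ℝ) * β ≤ m := fun i hi =>
      hi.trans ((hGub θ hθ).trans hNm)
    refine sub_le_of_hitting_time_le hκ hβ hε hFmono hFlip hθ (hGnn θ hθ) (hFnn θ hθ)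
      (fun i hi => ⟨S, hS, ?_⟩)
      fun i h1 hi => (abs_sub_le_iff.1 (hhit i h1 (level_le i (hle i hi)))).1
    rw [hFS S le_rfl]
    exact hle i hi
end
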